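/- arXiv:2303.03642 — 5 statements merged into one kernel-verified Lean document; each statement's English description precedes it below -/
import Mathlib

section
/- For every approval-based committee voting instance, there exists a randomized committee (λ_1, W_1), …, (λ_s, W_s) such that every integral committee W_j in its support satisfies EJR, and the fractional committee p that it implements satisfies both GFS and Strong UFS. -/
open Finset

namespace BWCV

variable {n m : ℕ}

/-- Utility of voter `i` for a fractional committee `p`. -/
def utility (A : Fin n → Finset (Fin m)) (p : Fin m → ℝ) (i : Fin n) : ℝ :=
  ∑ c ∈ A i, p c

/-- `p` is a fractional committee of size `k`. -/
def IsFractionalCommittee (k : ℕ) (p : Fin m → ℝ) : Prop :=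
  (∀ c, 0 ≤ p c ∧ p c ≤ 1) ∧ ∑ c, p c = (k : ℝ)

/-- Group Fair Share. -/
def GFS (k : ℕ) (A : Fin n → Finset (Fin m)) (p : Fin m → ℝ) : Prop :=
  ∀ S : Finset (Fin n),
    (1 / (n : ℝ)) * ∑ i ∈ S, ((min k (A i).card : ℕ) : ℝ) ≤ ∑ c ∈ S.biUnion A, p c

/-- Unanimous Fair Share. -/
def UFS (k : ℕ) (A : Fin n → Finset (Fin m)) (p : Fin m → ℝ) : Prop :=
  ∀ S : Finset (Fin n), (∀ i ∈ S, ∀ j ∈ S, A i = A j) →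
    ∀ i ∈ S, ((S.card : ℝ) / n) * ((min k (A i).card : ℕ) : ℝ) ≤ utility A p i

/-- Strong Unanimous Fair Share. -/
def StrongUFS (k : ℕ) (A : Fin n → Finset (Fin m)) (p : Fin m → ℝ) : Prop :=
  ∀ S : Finset (Fin n), (∀ i ∈ S, ∀ j ∈ S, A i = A j) →
    ∀ i ∈ S, min ((S.card : ℝ) * k / n) ((A i).card : ℝ) ≤ utility A p i

/-- Individual Fair Share. -/
def IFS (k : ℕ) (A : Fin n → Finset (Fin m)) (p : Fin m → ℝ) : Prop :=
  ∀ i, (1 / (n : ℝ)) * ((min k (A i).card : ℕ) : ℝ) ≤ utility A p i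

/-- Strong Individual Fair Share. -/
def StrongIFS (k : ℕ) (A : Fin n → Finset (Fin m)) (p : Fin m → ℝ) : Prop :=
  ∀ i, min ((k : ℝ) / n) ((A i).card : ℝ) ≤ utility A p i

/-- An `ℓ`-cohesive group of voters: `|N'| ≥ ℓ·n/k` and the voters in `N'`
commonly approve at least `ℓ` candidates. -/
def Cohesive (k : ℕ) (A : Fin n → Finset (Fin m)) (ℓ : ℕ) (N' : Finset (Fin n)) : Prop :=
  ((ℓ : ℝ) * n / k ≤ (N'.card : ℝ)) ∧ ℓ ≤ (N'.inf A).card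

/-- Justified Representation. -/
def JR (k : ℕ) (A : Fin n → Finset (Fin m)) (W : Finset (Fin m)) : Prop :=
  ∀ N' : Finset (Fin n), Cohesive k A 1 N' → ∃ i ∈ N', (A i ∩ W).Nonempty

/-- Proportional Justified Representation. -/
def PJR (k : ℕ) (A : Fin n → Finset (Fin m)) (W : Finset (Fin m)) : Prop :=
  ∀ ℓ : ℕ, 0 < ℓ → ∀ N' : Finset (Fin n), Cohesive k A ℓ N' →
    ℓ ≤ ((N'.biUnion A) ∩ W).card

/-- Extended Justified Representation. -/
def EJR (k : ℕ) (A : Fin n → Finset (Fin m)) (W : Finset (Fin m)) : Prop :=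
  ∀ ℓ : ℕ, 0 < ℓ → ∀ N' : Finset (Fin n), Cohesive k A ℓ N' →
    ∃ i ∈ N', ℓ ≤ (A i ∩ W).card

/-- EJR+. -/
def EJRplus (k : ℕ) (A : Fin n → Finset (Fin m)) (W : Finset (Fin m)) : Prop :=
  ¬ ∃ (c : Fin m) (N' : Finset (Fin n)) (ℓ : ℕ), c ∉ W ∧ 0 < ℓ ∧
      ((ℓ : ℝ) * n / k ≤ (N'.card : ℝ)) ∧ (∀ i ∈ N', c ∈ A i) ∧
      (∀ i ∈ N', (A i ∩ W).card < ℓ)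

/-- A weakly `(β, T)`-cohesive group of voters. -/
def WeaklyCohesive (k : ℕ) (A : Fin n → Finset (Fin m)) (β : ℕ) (T : Finset (Fin m))
    (N' : Finset (Fin n)) : Prop :=
  ((T.card : ℝ) * n / k ≤ (N'.card : ℝ)) ∧ ∀ i ∈ N', β ≤ (A i ∩ T).card

/-- Fully Justified Representation. -/
def FJR (k : ℕ) (A : Fin n → Finset (Fin m)) (W : Finset (Fin m)) : Prop :=
  ∀ β : ℕ, 0 < β → ∀ T : Finset (Fin m), ∀ N' : Finset (Fin n),
    WeaklyCohesive k A β T N' → ∃ i ∈ N', β ≤ (A i ∩ W).card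

/-- The randomized committee `(lam, W)` implements the fractional committee `p`. -/
def Implements {s : ℕ} (lam : Fin s → ℝ) (W : Fin s → Finset (Fin m)) (p : Fin m → ℝ) : Prop :=
  ∀ c, p c = ∑ j, lam j * (if c ∈ W j then 1 else 0)

/-- Voters with budget `k / n` each buy the candidates of `W` at unit price: voter `i` pays `y i c`
for `c`, only for approved candidates, never more than `r` for one candidate, and at least
`min k |A i ∩ W| / n` in total. -/
structure IsPaymentPlan (k : ℕ) (A : Fin n → Finset (Fin m)) (r : ℝ) (W : Finset (Fin m))
    (y : Fin n → Fin m → ℝ) : Prop where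
  nonneg : ∀ i c, 0 ≤ y i c
  le : ∀ i c, y i c ≤ r
  eq_zero : ∀ i c, c ∉ A i ∩ W → y i c = 0
  sum_eq_one : ∀ c ∈ W, ∑ i, y i c = 1
  sum_le : ∀ i, ∑ c, y i c ≤ (k : ℝ) / n
  le_sum : ∀ i, ((min k (A i ∩ W).card : ℕ) : ℝ) / n ≤ ∑ c, y i c

/-- The supporters of every candidate outside `W`, paying at most `r` each out of what they have
left, cannot afford it. -/
def Exhausted (k : ℕ) (A : Fin n → Finset (Fin m)) (r : ℝ) (W : Finset (Fin m))
    (y : Fin n → Fin m → ℝ) : Prop :=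
  ∀ c ∉ W, ∑ i with c ∈ A i, min ((k : ℝ) / n - ∑ c, y i c) r < 1

lemma IsPaymentPlan.mono {k : ℕ} {A : Fin n → Finset (Fin m)} {r r' : ℝ} {W : Finset (Fin m)}
    {y : Fin n → Fin m → ℝ} (h : IsPaymentPlan k A r W y) (hr : r ≤ r') :
    IsPaymentPlan k A r' W y :=
  { h with le := fun i c => (h.le i c).trans hr }

/-- Some common cap `ρ ≤ r` on the contributions raises exactly `1`. -/
lemma exists_cap_sum_min_eq_one {ι : Type*} (s : Finset ι) (b : ι → ℝ) (hb : ∀ i, 0 ≤ b i) {r : ℝ}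
    (hr : 0 ≤ r) (h : 1 ≤ ∑ i ∈ s, min (b i) r) :
    ∃ ρ, 0 ≤ ρ ∧ ρ ≤ r ∧ ∑ i ∈ s, min (b i) ρ = 1 := by
  have hc : ContinuousOn (fun ρ : ℝ => ∑ i ∈ s, min (b i) ρ) (Set.Icc 0 r) :=
    Continuous.continuousOn (by fun_prop)
  have h0 : ∑ i ∈ s, min (b i) 0 = 0 := sum_eq_zero fun i _ => min_eq_right (hb i)
  obtain ⟨ρ, hρ, hρ1⟩ := intermediate_value_Icc hr hc
    (show (1 : ℝ) ∈ Set.Icc _ _ from ⟨by simp only [h0]; norm_num, h⟩)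
  exact ⟨ρ, hρ.1, hρ.2, hρ1⟩

lemma IsPaymentPlan.insert {k : ℕ} {A : Fin n → Finset (Fin m)} {r : ℝ}
    {W : Finset (Fin m)} {y : Fin n → Fin m → ℝ} (hn : 0 < n) (hr : 0 ≤ r)
    (h : IsPaymentPlan k A r W y) {c : Fin m} (hc : c ∉ W)
    (hafford : 1 ≤ ∑ i with c ∈ A i, min ((k : ℝ) / n - ∑ c, y i c) r) :
    ∃ y', IsPaymentPlan k A r (insert c W) y' := by
  have hn' : (0 : ℝ) < n := by exact_mod_cast hn
  set b : Fin n → ℝ := fun i => (k : ℝ) / n - ∑ c, y i c with hb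
  have hb0 : ∀ i, 0 ≤ b i := fun i => sub_nonneg.2 (h.sum_le i)
  obtain ⟨ρ, hρ0, hρr, hρ⟩ := exists_cap_sum_min_eq_one _ b hb0 hr hafford
  have hρn : 1 / (n : ℝ) ≤ ρ := by
    rw [div_le_iff₀ hn', ← hρ]
    calc ∑ i with c ∈ A i, min (b i) ρ ≤ ∑ i with c ∈ A i, ρ :=
          sum_le_sum fun i _ => min_le_right _ _
      _ = ((univ.filter fun i => c ∈ A i).card : ℝ) * ρ := by simp
      _ ≤ n * ρ := by
          gcongr
          simpa using card_le_univ (univ.filter fun i => c ∈ A i)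
      _ = ρ * n := mul_comm _ _
  have hyc : ∀ i, y i c = 0 := fun i => h.eq_zero i c (by simp [hc])
  set t : Fin n → ℝ := fun i => if c ∈ A i then min (b i) ρ else 0 with ht
  have ht0 : ∀ i, 0 ≤ t i := fun i => by
    simp only [ht]; split_ifs
    exacts [le_min (hb0 i) hρ0, le_rfl]
  have htr : ∀ i, t i ≤ r := fun i => by
    simp only [ht]; split_ifs
    exacts [(min_le_right _ _).trans hρr, hr]
  have htb : ∀ i, t i ≤ b i := fun i => by
    simp only [ht]; split_ifs
    exacts [min_le_left _ _, hb0 i]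
  have hsum : ∀ i, ∑ d, (y i d + if d = c then t i else 0) = ∑ d, y i d + t i := fun i => by
    rw [sum_add_distrib]; simp
  refine ⟨fun i d => y i d + if d = c then t i else 0, ?_, ?_, ?_, ?_, ?_, ?_⟩
  · intro i d
    have := h.nonneg i d
    have := ht0 i
    split_ifs <;> linarith
  · intro i d
    split_ifs with hd
    · subst hd
      rw [hyc, zero_add]; exact htr i
    · rw [add_zero]; exact h.le i d
  · intro i d hd
    have h1 : y i d = 0 := h.eq_zero i d (by
      simp only [mem_inter, mem_insert] at hd ⊢; tauto)
    rw [h1]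
    split_ifs with hdc
    · subst hdc
      have : d ∉ A i := by simpa using hd
      simp [ht, this]
    · simp
  · intro d hd
    rw [sum_add_distrib]
    by_cases hdc : d = c
    · subst hdc
      rw [sum_eq_zero fun i _ => hyc i]
      simp only [if_true, zero_add, ht]
      rw [← sum_filter]; exact hρ
    · simp only [hdc, if_false, sum_const_zero, add_zero]
      exact h.sum_eq_one d ((mem_insert.1 hd).resolve_left hdc)
  · intro i
    rw [hsum]
    have := htb i
    simp only [hb] at this
    linarith
  · intro i
    rw [hsum]
    by_cases hi : c ∈ A i
    · have hcard : (A i ∩ Insert.insert c W).card = (A i ∩ W).card + 1 := by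
        rw [inter_insert_of_mem hi, card_insert_of_notMem (by simp [hc])]
      rw [hcard]
      have hti : t i = min (b i) ρ := by simp [ht, hi]
      have hls := h.le_sum i
      rw [hti]
      rcases min_cases (b i) ρ with ⟨h1, _⟩ | ⟨h1, _⟩ <;> rw [h1]
      · have : ((min k ((A i ∩ W).card + 1) : ℕ) : ℝ) / n ≤ (k : ℝ) / n := by
          gcongr; exact min_le_left _ _
        simp only [hb]; linarith
      · have : ((min k ((A i ∩ W).card + 1) : ℕ) : ℝ) ≤ (min k (A i ∩ W).card : ℕ) + 1 := by
          exact_mod_cast (by omega :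
            min k ((A i ∩ W).card + 1) ≤ min k (A i ∩ W).card + 1)
        have h2 : ((min k ((A i ∩ W).card + 1) : ℕ) : ℝ) / n
            ≤ ((min k (A i ∩ W).card : ℕ) + 1) / n := by gcongr
        rw [add_div] at h2
        linarith
    · rw [inter_insert_of_notMem hi]
      linarith [h.le_sum i, ht0 i]

lemma IsPaymentPlan.exists_exhausted {k : ℕ} {A : Fin n → Finset (Fin m)} {r : ℝ}
    {W : Finset (Fin m)} {y : Fin n → Fin m → ℝ} (hn : 0 < n) (hr : 0 ≤ r)
    (h : IsPaymentPlan k A r W y) :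
    ∃ W' y', W ⊆ W' ∧ IsPaymentPlan k A r W' y' ∧ Exhausted k A r W' y' := by
  induction hN : Wᶜ.card using Nat.strong_induction_on generalizing W y with
  | _ N ih =>
    by_cases hex : Exhausted k A r W y
    · exact ⟨W, y, Subset.rfl, h, hex⟩
    · simp only [Exhausted] at hex
      push Not at hex
      obtain ⟨c, hc, hafford⟩ := hex
      obtain ⟨y', hy'⟩ := h.insert hn hr hc hafford
      have hlt : (Insert.insert c W)ᶜ.card < N := by
        rw [← hN]
        exact card_lt_card (compl_ssubset_compl.2 (ssubset_insert hc))
      obtain ⟨W'', y'', hW, hrest⟩ := ih _ hlt hy' rfl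
      exact ⟨W'', y'', (subset_insert c W).trans hW, hrest⟩

lemma IsPaymentPlan.exists_le_card_inter {k ℓ : ℕ} {A : Fin n → Finset (Fin m)}
    {W : Finset (Fin m)} {y : Fin n → Fin m → ℝ} (hn : 0 < n) (hk : 0 < k) (hℓ : 0 < ℓ)
    (h : IsPaymentPlan k A ((k : ℝ) / (ℓ * n)) W y)
    (hex : Exhausted k A ((k : ℝ) / (ℓ * n)) W y)
    {N' : Finset (Fin n)} (hN : Cohesive k A ℓ N') : ∃ i ∈ N', ℓ ≤ (A i ∩ W).card := by
  by_contra! hlt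
  have hn' : (0 : ℝ) < n := by exact_mod_cast hn
  have hk' : (0 : ℝ) < k := by exact_mod_cast hk
  have hℓ' : (0 : ℝ) < ℓ := by exact_mod_cast hℓ
  obtain ⟨hsize, hcommon⟩ := hN
  have hNpos : (0 : ℝ) < N'.card := lt_of_lt_of_le (by positivity) hsize
  obtain ⟨i₀, hi₀⟩ : N'.Nonempty := card_pos.1 (by exact_mod_cast hNpos)
  obtain ⟨c, hc, hcW⟩ : ∃ c ∈ N'.inf A, c ∉ W := by
    by_contra! hall
    have : N'.inf A ⊆ A i₀ ∩ W := fun c hc =>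
      mem_inter.2 ⟨(inf_le hi₀ : N'.inf A ≤ A i₀) hc, hall c hc⟩
    have := card_le_card this
    have := hlt i₀ hi₀
    omega
  set r : ℝ := (k : ℝ) / (ℓ * n) with hr
  have hr0 : 0 < r := by positivity
  have hleft : ∀ i ∈ N', r ≤ (k : ℝ) / n - ∑ c, y i c := by
    intro i hi
    have h1 : ∑ c, y i c = ∑ c ∈ A i ∩ W, y i c :=
      (sum_subset (subset_univ _) fun c _ hc => h.eq_zero i c hc).symm
    have h2 : ∑ c ∈ A i ∩ W, y i c ≤ (A i ∩ W).card * r := by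
      simpa using sum_le_card_nsmul (A i ∩ W) (y i) r fun c _ => h.le i c
    have h3 : ((A i ∩ W).card : ℝ) + 1 ≤ ℓ := by exact_mod_cast hlt i hi
    have h4 : (k : ℝ) / n = ℓ * r := by rw [hr]; field_simp
    nlinarith [mul_le_mul_of_nonneg_right h3 hr0.le]
  refine absurd (hex c hcW) (not_lt.2 ?_)
  have hsub : N' ⊆ univ.filter fun i => c ∈ A i := fun i hi =>
    mem_filter.2 ⟨mem_univ _, (inf_le hi : N'.inf A ≤ A i) hc⟩
  calc (1 : ℝ) = (ℓ * n / k) * r := by rw [hr]; field_simp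
    _ ≤ N'.card * r := by gcongr
    _ = ∑ i ∈ N', min ((k : ℝ) / n - ∑ c, y i c) r := by
        rw [sum_congr rfl fun i hi => min_eq_right (hleft i hi)]; simp
    _ ≤ ∑ i with c ∈ A i, min ((k : ℝ) / n - ∑ c, y i c) r :=
        sum_le_sum_of_subset_of_nonneg hsub fun i _ _ =>
          le_min (sub_nonneg.2 (h.sum_le i)) hr0.le

lemma EJR.mono {k : ℕ} {A : Fin n → Finset (Fin m)} {W W' : Finset (Fin m)} (h : EJR k A W)
    (hW : W ⊆ W') : EJR k A W' := fun ℓ hℓ N' hN => by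
  obtain ⟨i, hi, hle⟩ := h ℓ hℓ N' hN
  exact ⟨i, hi, hle.trans (card_le_card (inter_subset_inter_left hW))⟩

lemma Cohesive.le {k ℓ : ℕ} {A : Fin n → Finset (Fin m)} {N' : Finset (Fin n)} (hn : 0 < n)
    (hk : 0 < k) (h : Cohesive k A ℓ N') : ℓ ≤ k := by
  have hnpos : (0 : ℝ) < n := by exact_mod_cast hn
  have hkpos : (0 : ℝ) < k := by exact_mod_cast hk
  have h1 : (N'.card : ℝ) ≤ n := by exact_mod_cast (by simpa using card_le_univ N')
  have h2 := h.1.trans h1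
  rw [div_le_iff₀ hkpos, mul_comm (n : ℝ)] at h2
  exact_mod_cast le_of_mul_le_mul_right h2 hnpos

/-- Buying candidates under the successively larger payment caps `k / (ℓ n)`, for `ℓ = k, …, 1`,
yields an affordable EJR committee with no affordable candidate left. -/
lemma exists_isPaymentPlan_EJR {k : ℕ} (A : Fin n → Finset (Fin m)) (hn : 0 < n) (hk : 0 < k) :
    ∃ W y, IsPaymentPlan k A ((k : ℝ) / n) W y ∧ Exhausted k A ((k : ℝ) / n) W y ∧ EJR k A W := by
  have key : ∀ ℓ, 1 ≤ ℓ → ℓ ≤ k + 1 → ∃ W y, IsPaymentPlan k A ((k : ℝ) / (ℓ * n)) W y ∧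
      ∀ ℓ', ℓ ≤ ℓ' → ∀ N', Cohesive k A ℓ' N' → ∃ i ∈ N', ℓ' ≤ (A i ∩ W).card := by
    intro ℓ hℓ hℓk
    induction hℓk using Nat.decreasingInduction with
    | self =>
      refine ⟨∅, fun _ _ => 0, ⟨?_, ?_, ?_, ?_, ?_, ?_⟩, fun ℓ' hℓ' N' hN => ?_⟩
      · simp
      · intro i c; positivity
      · simp
      · simp
      · intro i; simp only [sum_const_zero]; positivity
      · simp
      · have := hN.le hn hk
        omega
    | of_succ ℓ hlt ih =>
      obtain ⟨W, y, hy, hE⟩ := ih (by omega)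
      have hcap : (k : ℝ) / ((ℓ + 1 : ℕ) * n) ≤ k / (ℓ * n) := by
        have : (0 : ℝ) < n := by exact_mod_cast hn
        have : (0 : ℝ) < ℓ := by exact_mod_cast hℓ
        gcongr; omega
      obtain ⟨W', y', hW, hy', hex⟩ := (hy.mono hcap).exists_exhausted hn (by positivity)
      refine ⟨W', y', hy', fun ℓ' hℓ' N' hN => ?_⟩
      rcases hℓ'.eq_or_lt with rfl | hlt'
      · exact hy'.exists_le_card_inter hn hk hℓ hex hN
      · obtain ⟨i, hi, hle⟩ := hE ℓ' hlt' N' hN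
        exact ⟨i, hi, hle.trans (card_le_card (inter_subset_inter_left hW))⟩
  obtain ⟨W, y, hy, hE⟩ := key 1 le_rfl (by omega)
  rw [Nat.cast_one, one_mul] at hy
  obtain ⟨W', y', hW, hy', hex⟩ := hy.exists_exhausted hn (by positivity)
  have hEJR : EJR k A W := hE
  exact ⟨W', y', hy', hex, hEJR.mono hW⟩

/-- A fractional vector in the unit cube of total weight at most `k` can be increased to a
fractional committee. -/
lemma exists_isFractionalCommittee_ge {k : ℕ} (hkm : k ≤ m) (q : Fin m → ℝ) (h0 : ∀ c, 0 ≤ q c)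
    (h1 : ∀ c, q c ≤ 1) (hq : ∑ c, q c ≤ k) :
    ∃ p, IsFractionalCommittee k p ∧ ∀ c, q c ≤ p c := by
  rcases hq.eq_or_lt with hq | hq
  · exact ⟨q, ⟨fun c => ⟨h0 c, h1 c⟩, hq⟩, fun _ => le_rfl⟩
  have hkm' : (k : ℝ) ≤ m := by exact_mod_cast hkm
  have hpos : 0 < (m : ℝ) - ∑ c, q c := by linarith
  set t : ℝ := (k - ∑ c, q c) / (m - ∑ c, q c) with ht
  have ht0 : 0 ≤ t := div_nonneg (by linarith) hpos.le
  have ht1 : t ≤ 1 := (div_le_one hpos).2 (by linarith)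
  have hge : ∀ c, q c ≤ q c + t * (1 - q c) := fun c => by
    nlinarith [mul_nonneg ht0 (sub_nonneg.2 (h1 c))]
  refine ⟨fun c => q c + t * (1 - q c), ⟨fun c => ⟨(h0 c).trans (hge c), ?_⟩, ?_⟩, hge⟩
  · nlinarith [mul_le_mul_of_nonneg_right ht1 (sub_nonneg.2 (h1 c))]
  · rw [sum_add_distrib, ← mul_sum, sum_sub_distrib]
    simp only [sum_const, card_univ, Fintype.card_fin, nsmul_eq_mul, mul_one]
    rw [ht, div_mul_cancel₀ _ hpos.ne']
    ring

/-- Moving weight from `b` to `a` until one of the two becomes integral. -/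
lemma IsFractionalCommittee.exists_shift {k : ℕ} {p : Fin m → ℝ} (hp : IsFractionalCommittee k p)
    {a b : Fin m} (hab : a ≠ b) (ha : 0 < p a ∧ p a < 1) (hb : 0 < p b ∧ p b < 1) :
    ∃ (q : Fin m → ℝ) (ε : ℝ), 0 < ε ∧ q = p + ε • (Pi.single a 1 - Pi.single b 1) ∧
      IsFractionalCommittee k q ∧ (∀ c, p c = 1 → q c = 1) ∧
      (univ.filter fun c => 0 < q c ∧ q c < 1) ⊂ univ.filter fun c => 0 < p c ∧ p c < 1 := by
  set ε := min (1 - p a) (p b) with hε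
  have hε0 : 0 < ε := lt_min (by linarith) hb.1
  have hεa : ε ≤ 1 - p a := min_le_left _ _
  have hεb : ε ≤ p b := min_le_right _ _
  set q : Fin m → ℝ := p + ε • (Pi.single a 1 - Pi.single b 1) with hq
  have hqa : q a = p a + ε := by simp [hq, hab]
  have hqb : q b = p b - ε := by simp [hq, hab.symm]; ring
  have hqc : ∀ c, c ≠ a → c ≠ b → q c = p c := fun c h1 h2 => by simp [hq, h1, h2]
  refine ⟨q, ε, hε0, hq, ⟨fun c => ?_, ?_⟩, fun c hc => ?_, ?_⟩
  · by_cases h1 : c = a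
    · subst h1; rw [hqa]; constructor <;> linarith
    by_cases h2 : c = b
    · subst h2; rw [hqb]; constructor <;> linarith
    rw [hqc c h1 h2]; exact hp.1 c
  · simp only [hq, Pi.add_apply, Pi.smul_apply, Pi.sub_apply, smul_eq_mul, sum_add_distrib,
      ← mul_sum, sum_sub_distrib, hp.2]
    simp
  · rw [hqc c (by rintro rfl; linarith) (by rintro rfl; linarith), hc]
  · refine (ssubset_iff_of_subset fun c hc => ?_).2 ?_
    · rw [mem_filter] at hc ⊢
      by_cases h1 : c = a
      · subst h1; exact ⟨mem_univ _, ha⟩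
      by_cases h2 : c = b
      · subst h2; exact ⟨mem_univ _, hb⟩
      rwa [hqc c h1 h2] at hc
    · rcases min_cases (1 - p a) (p b) with ⟨h1, _⟩ | ⟨h1, _⟩
      · exact ⟨a, by simpa using ha, by simp [hqa, hε, h1]⟩
      · exact ⟨b, by simpa using hb, by simp [hqb, hε, h1]⟩

/-- A fractional committee is a convex combination of integral committees that contain all
candidates of weight one. -/
lemma IsFractionalCommittee.mem_convexHull {k : ℕ} {p : Fin m → ℝ}
    (hp : IsFractionalCommittee k p) {W : Finset (Fin m)} (hW : ∀ c ∈ W, p c = 1) :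
    p ∈ convexHull ℝ {x : Fin m → ℝ | ∃ V : Finset (Fin m), V.card = k ∧ W ⊆ V ∧
      ∀ c, x c = if c ∈ V then 1 else 0} := by
  induction hN : (univ.filter fun c => 0 < p c ∧ p c < 1).card using Nat.strong_induction_on
    generalizing p with
  | _ N ih =>
    rcases (univ.filter fun c => 0 < p c ∧ p c < 1).eq_empty_or_nonempty with hF | ⟨a, ha⟩
    · have h01 : ∀ c, p c = if c ∈ univ.filter (fun c => p c = 1) then 1 else 0 := by
        intro c
        have hc : c ∉ univ.filter fun c => 0 < p c ∧ p c < 1 := by simp [hF]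
        simp only [mem_filter, mem_univ, true_and, not_and, not_lt] at hc ⊢
        obtain ⟨h0, h1⟩ := hp.1 c
        split_ifs with h
        · exact h
        · by_contra hne
          exact h (le_antisymm h1 (hc (lt_of_le_of_ne h0 (Ne.symm hne))))
      refine subset_convexHull _ _ ⟨univ.filter fun c => p c = 1, ?_, ?_, h01⟩
      · have := hp.2
        rw [sum_congr rfl fun c _ => h01 c, sum_ite_mem, univ_inter] at this
        simpa using this
      · intro c hc
        simpa using hW c hc
    · obtain ⟨b, hb, hab⟩ : ∃ b ∈ univ.filter (fun c => 0 < p c ∧ p c < 1), a ≠ b := by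
        by_contra! hall
        have h01 : ∀ c ∈ univ.erase a, p c = if p c = 1 then 1 else 0 := by
          intro c hc
          have hc' : c ∉ univ.filter fun c => 0 < p c ∧ p c < 1 := fun h =>
            (mem_erase.1 hc).1 (hall c h).symm
          simp only [mem_filter, mem_univ, true_and, not_and, not_lt] at hc'
          obtain ⟨h0, h1⟩ := hp.1 c
          split_ifs with h
          · exact h
          · by_contra hne
            exact h (le_antisymm h1 (hc' (lt_of_le_of_ne h0 (Ne.symm hne))))
        have hs := hp.2
        rw [← add_sum_erase _ _ (mem_univ a), sum_congr rfl h01, sum_boole] at hs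
        simp only [mem_filter, mem_univ, true_and] at ha
        set j := ((univ.erase a).filter fun c => p c = 1).card
        have h1 : j < k := by
          have : (j : ℝ) < k := by linarith
          exact_mod_cast this
        have h2 : k < j + 1 := by
          have : (k : ℝ) < j + 1 := by linarith
          exact_mod_cast this
        omega
      simp only [mem_filter, mem_univ, true_and] at ha hb
      obtain ⟨q₁, ε, hε, hq₁, hp₁, hone₁, hlt₁⟩ := hp.exists_shift hab ha hb
      obtain ⟨q₂, δ, hδ, hq₂, hp₂, hone₂, hlt₂⟩ := hp.exists_shift hab.symm hb ha
      have h₁ := ih _ (hN ▸ card_lt_card hlt₁) hp₁ (fun c hc => hone₁ c (hW c hc)) rfl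
      have h₂ := ih _ (hN ▸ card_lt_card hlt₂) hp₂ (fun c hc => hone₂ c (hW c hc)) rfl
      have hsum : 0 < δ + ε := by positivity
      have := convex_convexHull ℝ _ h₁ h₂ (a := δ / (δ + ε)) (b := ε / (δ + ε))
        (by positivity) (by positivity) (by field_simp)
      convert this using 1
      ext c
      simp only [hq₁, hq₂, Pi.add_apply, Pi.smul_apply, Pi.sub_apply, smul_eq_mul]
      field_simp
      ring

/-- A fractional committee is implemented by integral committees that contain all candidates of
weight one. -/
lemma IsFractionalCommittee.exists_implements {k : ℕ} {p : Fin m → ℝ}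
    (hp : IsFractionalCommittee k p) {W : Finset (Fin m)} (hW : ∀ c ∈ W, p c = 1) :
    ∃ s : ℕ, 0 < s ∧ ∃ (lam : Fin s → ℝ) (V : Fin s → Finset (Fin m)),
      (∀ j, 0 ≤ lam j) ∧ ∑ j, lam j = 1 ∧ (∀ j, (V j).card = k) ∧ (∀ j, W ⊆ V j) ∧
      Implements lam V p := by
  obtain ⟨ι, _, w, z, hw0, hw1, hz, hsum⟩ :=
    mem_convexHull_iff_exists_fintype.1 (hp.mem_convexHull hW)
  choose V hcard hsub hV using hz
  let e := (Fintype.equivFin ι).symm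
  have hlam : ∑ j, w (e j) = 1 := by rw [e.sum_comp w, hw1]
  refine ⟨Fintype.card ι, ?_, fun j => w (e j), fun j => V (e j), fun j => hw0 _, hlam,
    fun j => hcard _, fun j => hsub _, fun c => ?_⟩
  · by_contra h0
    have : IsEmpty (Fin (Fintype.card ι)) := by
      rw [Nat.eq_zero_of_not_pos h0]; infer_instance
    simp at hlam
  · rw [e.sum_comp fun i => w i * if c ∈ V i then 1 else 0, ← hsum]
    simp [hV]

/-- An exhausted payment plan extends so that every voter approving a candidate outside `W`
spends her whole budget on approved candidates. -/
lemma IsPaymentPlan.exists_spending {k : ℕ} {A : Fin n → Finset (Fin m)} {W : Finset (Fin m)}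
    {y : Fin n → Fin m → ℝ} (h : IsPaymentPlan k A ((k : ℝ) / n) W y)
    (hex : Exhausted k A ((k : ℝ) / n) W y) :
    ∃ Y : Fin n → Fin m → ℝ, (∀ i c, 0 ≤ Y i c) ∧ (∀ i, ∀ c ∉ A i, Y i c = 0) ∧
      (∀ c ∈ W, ∑ i, Y i c = 1) ∧ (∀ c, ∑ i, Y i c ≤ 1) ∧
      (∀ i, ∑ c, Y i c ≤ (k : ℝ) / n) ∧ (∀ i, ¬ A i ⊆ W → ∑ c, Y i c = (k : ℝ) / n) ∧
      ∀ i, ((min k (A i).card : ℕ) : ℝ) / n ≤ ∑ c, Y i c := by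
  classical
  set b : Fin n → ℝ := fun i => (k : ℝ) / n - ∑ c, y i c with hb
  have hb0 : ∀ i, 0 ≤ b i := fun i => sub_nonneg.2 (h.sum_le i)
  have hchoice : ∀ i, ∃ z : Fin m → ℝ, (∀ c, 0 ≤ z c) ∧ (∀ c, c ∉ A i \ W → z c = 0) ∧
      (∀ c, z c ≤ b i) ∧ ∑ c, z c ≤ b i ∧ (¬ A i ⊆ W → ∑ c, z c = b i) := by
    intro i
    by_cases hi : A i ⊆ W
    · exact ⟨fun _ => 0, by simp, by simp, fun _ => hb0 i, by simpa using hb0 i,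
        fun hi' => absurd hi hi'⟩
    · obtain ⟨d, hd, hdW⟩ := not_subset.1 hi
      refine ⟨fun c => if c = d then b i else 0, fun c => ?_, fun c hc => ?_, fun c => ?_,
        by simp, by simp⟩
      · dsimp only; split_ifs
        exacts [hb0 i, le_rfl]
      · exact if_neg (by rintro rfl; exact hc (mem_sdiff.2 ⟨hd, hdW⟩))
      · dsimp only; split_ifs
        exacts [le_rfl, hb0 i]
  choose z hz0 hzsupp hzle hzsum hzeq using hchoice
  have hfull : ∀ i, ¬ A i ⊆ W → ∑ c, (y i c + z i c) = (k : ℝ) / n := fun i hi => by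
    rw [sum_add_distrib, hzeq i hi]; simp [hb]
  have hWone : ∀ c ∈ W, ∑ i, (y i c + z i c) = 1 := fun c hc => by
    rw [sum_add_distrib, h.sum_eq_one c hc,
      sum_eq_zero fun i _ => hzsupp i c (by simp [hc]), add_zero]
  refine ⟨fun i c => y i c + z i c, fun i c => add_nonneg (h.nonneg i c) (hz0 i c),
    fun i c hc => ?_, hWone, fun c => ?_, fun i => ?_, hfull, fun i => ?_⟩
  · dsimp only
    rw [h.eq_zero i c (by simp [hc]), hzsupp i c (by simp [hc]), add_zero]
  · by_cases hc : c ∈ W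
    · exact (hWone c hc).le
    · refine le_trans ?_ (hex c hc).le
      rw [sum_filter]
      refine sum_le_sum fun i _ => ?_
      simp only [h.eq_zero i c (by simp [hc]), zero_add]
      split_ifs with hi
      · refine le_min (hzle i c) ((hzle i c).trans ?_)
        exact sub_le_self _ (sum_nonneg fun c _ => h.nonneg i c)
      · exact (hzsupp i c (by simp [hi])).le
  · rw [sum_add_distrib]
    have := hzsum i
    simp only [hb] at this
    linarith
  · by_cases hi : A i ⊆ W
    · have := h.le_sum i
      rw [inter_eq_left.2 hi] at this
      exact this.trans (sum_le_sum fun c _ => le_add_of_nonneg_right (hz0 i c))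
    · dsimp only
      rw [hfull i hi]
      gcongr
      exact min_le_left _ _

lemma sum_spending_le {A : Fin n → Finset (Fin m)} {Y : Fin n → Fin m → ℝ} {p : Fin m → ℝ}
    (hY0 : ∀ i c, 0 ≤ Y i c) (hYA : ∀ i, ∀ c ∉ A i, Y i c = 0) (hYp : ∀ c, ∑ i, Y i c ≤ p c)
    (S : Finset (Fin n)) {T : Finset (Fin m)} (hT : ∀ i ∈ S, A i ⊆ T) :
    ∑ i ∈ S, ∑ c, Y i c ≤ ∑ c ∈ T, p c := by
  calc ∑ i ∈ S, ∑ c, Y i c = ∑ i ∈ S, ∑ c ∈ T, Y i c := sum_congr rfl fun i hi =>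
        (sum_subset (subset_univ _) fun c _ hc => hYA i c fun h => hc (hT i hi h)).symm
    _ = ∑ c ∈ T, ∑ i ∈ S, Y i c := sum_comm
    _ ≤ ∑ c ∈ T, p c := sum_le_sum fun c _ =>
        (sum_le_univ_sum_of_nonneg fun i => hY0 i c).trans (hYp c)

theorem bw_mes_exists (n m k : ℕ) (hn : 0 < n) (hk : 0 < k) (hkm : k ≤ m)
    (A : Fin n → Finset (Fin m)) (hA : ∀ i, (A i).Nonempty) :
    ∃ (s : ℕ), 0 < s ∧ ∃ (lam : Fin s → ℝ) (W : Fin s → Finset (Fin m)) (p : Fin m → ℝ),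
      (∀ j, 0 ≤ lam j) ∧ (∑ j, lam j = 1) ∧ (∀ j, (W j).card = k) ∧
      Implements lam W p ∧
      (∀ j, EJR k A (W j)) ∧ GFS k A p ∧ StrongUFS k A p := by
  obtain ⟨V, y, hy, hex, hEJR⟩ := exists_isPaymentPlan_EJR A hn hk
  obtain ⟨Y, hY0, hYA, hYV, hY1, hYle, hYfull, hYmin⟩ := hy.exists_spending hex
  have htotal : ∑ c, ∑ i, Y i c ≤ (k : ℝ) := by
    rw [sum_comm]
    calc ∑ i, ∑ c, Y i c ≤ ∑ _i : Fin n, (k : ℝ) / n := sum_le_sum fun i _ => hYle i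
      _ = k := by
          have : (n : ℝ) ≠ 0 := by exact_mod_cast hn.ne'
          simp only [sum_const, card_univ, Fintype.card_fin, nsmul_eq_mul]
          field_simp
  obtain ⟨p, hp, hYp⟩ := exists_isFractionalCommittee_ge hkm (fun c => ∑ i, Y i c)
    (fun c => sum_nonneg fun i _ => hY0 i c) hY1 htotal
  have hpV : ∀ c ∈ V, p c = 1 := fun c hc =>
    le_antisymm (hp.1 c).2 ((hYV c hc).symm.le.trans (hYp c))
  obtain ⟨s, hs, lam, W, hlam0, hlam1, hcard, hVW, himp⟩ := hp.exists_implements hpV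
  refine ⟨s, hs, lam, W, p, hlam0, hlam1, hcard, himp, fun j => hEJR.mono (hVW j), ?_, ?_⟩
  · intro S
    refine le_trans ?_ (sum_spending_le hY0 hYA hYp S fun i hi => subset_biUnion_of_mem A hi)
    rw [mul_sum]
    exact sum_le_sum fun i _ => by
      rw [one_div_mul_eq_div]; exact hYmin i
  · intro S hS i hi
    by_cases hsub : A i ⊆ V
    · refine (min_le_right _ _).trans (le_of_eq ?_)
      rw [utility, sum_congr rfl fun c hc => hpV c (hsub hc)]
      simp
    · refine (min_le_left _ _).trans ?_
      refine le_trans (le_of_eq ?_)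
        (sum_spending_le hY0 hYA hYp S fun j hj => (hS j hj i hi).subset)
      rw [sum_congr rfl fun j hj => hYfull j (by rwa [hS j hj i hi])]
      simp [mul_div_assoc]

end BWCV
end

section
/- Let an approval-based committee voting instance be given, and suppose that for each voter i ∈ N, W_i is an integral committee with |A_i ∩ W_i| = min(k, |A_i|) (i.e., a most preferred size-k committee for voter i). Then the fractional committee p defined by p(c) = (1/n) · |{i ∈ N : c ∈ W_i}| satisfies GFS. -/
open Finset

namespace BWCV

variable {n m : ℕ}

theorem random_dictator_GFS (n m k : ℕ) (hn : 0 < n) (hk : 0 < k) (hkm : k ≤ m)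
    (A : Fin n → Finset (Fin m)) (hA : ∀ i, (A i).Nonempty)
    (W : Fin n → Finset (Fin m)) (hW : ∀ i, (W i).card = k)
    (hbest : ∀ i, (A i ∩ W i).card = min k (A i).card) :
    GFS k A (fun c => (1 / (n : ℝ)) * (((univ.filter fun i => c ∈ W i).card : ℕ) : ℝ)) := by
  intro S
  have hcount : ∑ c ∈ S.biUnion A, (univ.filter fun i => c ∈ W i).card
      = ∑ i, (S.biUnion A ∩ W i).card := by
    simpa only [bipartiteAbove, bipartiteBelow, filter_mem_eq_inter] using
      sum_card_bipartiteAbove_eq_sum_card_bipartiteBelow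
        (s := S.biUnion A) (t := univ) (fun c i => c ∈ W i)
  have hle : ∑ i ∈ S, min k (A i).card
      ≤ ∑ c ∈ S.biUnion A, (univ.filter fun i => c ∈ W i).card := by
    rw [hcount]
    calc ∑ i ∈ S, min k (A i).card = ∑ i ∈ S, (A i ∩ W i).card :=
          sum_congr rfl fun i _ => (hbest i).symm
      _ ≤ ∑ i ∈ S, (S.biUnion A ∩ W i).card :=
          sum_le_sum fun i hi =>
            card_le_card (inter_subset_inter_right (subset_biUnion_of_mem A hi))
      _ ≤ ∑ i, (S.biUnion A ∩ W i).card := sum_le_sum_of_subset (subset_univ S)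
  rw [← mul_sum]
  exact mul_le_mul_of_nonneg_left (mod_cast hle) (by positivity)

end BWCV
end

section
/- In any approval-based committee voting instance, if an integral committee W (identified with the fractional committee 1_W) satisfies IFS, then W satisfies JR. -/
open Finset

namespace BWCV

variable {n m : ℕ}

theorem IFS_implies_JR (n m k : ℕ) (hn : 0 < n) (hk : 0 < k) (hkm : k ≤ m)
    (A : Fin n → Finset (Fin m)) (hA : ∀ i, (A i).Nonempty)
    (W : Finset (Fin m)) (hW : W.card = k)
    (hIFS : IFS k A (fun c => if c ∈ W then (1 : ℝ) else 0)) :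
    JR k A W := by
  intro N' hN
  have hN_pos : (0 : ℝ) < N'.card := lt_of_lt_of_le (by positivity) hN.1
  obtain ⟨i, hi⟩ := Finset.card_pos.mp (Nat.cast_pos.mp hN_pos)
  refine ⟨i, hi, ?_⟩
  have h_share : (0 : ℝ) < (1 / (n : ℝ)) * ((min k (A i).card : ℕ) : ℝ) :=
    mul_pos (by positivity) (Nat.cast_pos.mpr (lt_min hk (hA i).card_pos))
  simpa [utility] using h_share.trans_le (hIFS i)

end BWCV
end

section
/- There exist an approval-based committee voting instance and an integral committee W such that 1_W satisfies GFS but W does not satisfy PJR. Concretely: n = 2 voters, C = {c_1, …, c_5}, k = 4, A_1 = {c_1, c_2}, A_2 = {c_2, c_3, c_4, c_5}, and W = {c_2, c_3, c_4, c_5}. -/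
open Finset

namespace BWCV

variable {n m : ℕ}

def A₅ : Fin 2 → Finset (Fin 5) := ![{0, 1}, {1, 2, 3, 4}]

def W₅ : Finset (Fin 5) := {1, 2, 3, 4}

theorem GFS_not_implies_PJR :
    GFS 4 A₅ (fun c => if c ∈ W₅ then (1 : ℝ) else 0) ∧ ¬ PJR 4 A₅ W₅ := by
  constructor
  · intro S
    have h : ∀ S : Finset (Fin 2),
        ∑ i ∈ S, min 4 (A₅ i).card ≤ 2 * ((S.biUnion A₅).filter (· ∈ W₅)).card := by decide
    have hS : ((∑ i ∈ S, min 4 (A₅ i).card : ℕ) : ℝ) ≤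
        ((2 * ((S.biUnion A₅).filter (· ∈ W₅)).card : ℕ) : ℝ) := Nat.cast_le.mpr (h S)
    rw [Nat.cast_sum, Nat.cast_mul] at hS
    rw [Finset.sum_boole]
    push_cast at hS ⊢
    linarith
  · intro h
    have hc : Cohesive 4 A₅ 2 {0} := ⟨by norm_num, by decide⟩
    exact absurd (h 2 two_pos {0} hc) (by decide)

end BWCV
end

section
/- There exist an approval-based committee voting instance and two integral committees W and W' such that: W satisfies EJR but some voter i has A_i ∩ W = ∅ (so 1_W violates positive share), while W' satisfies both EJR and IFS. Concretely: n = 10 voters, C = {c_1, …, c_5}, k = 4, where voters 1–8 have A_i = {c_1, c_2, c_3, c_4} and voters 9–10 have A_i = {c_5}; W = {c_1, c_2, c_3, c_4} and W' = {c_1, c_2, c_3, c_5}. -/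
open Finset

namespace BWCV

variable {n m : ℕ}

def A₁₉ : Fin 10 → Finset (Fin 5) := fun i => if (i : ℕ) < 8 then {0, 1, 2, 3} else {4}

def W₁₉ : Finset (Fin 5) := {0, 1, 2, 3}

def W₁₉' : Finset (Fin 5) := {0, 1, 2, 4}

/-- A cohesive group consists of voters of the first block only, and its level is at most `3`. -/
lemma Cohesive.exists_lt_eight_and_le_three {ℓ : ℕ} (hℓ : 0 < ℓ) {N' : Finset (Fin 10)}
    (h : Cohesive 4 A₁₉ ℓ N') : (∃ i ∈ N', (i : ℕ) < 8) ∧ ℓ ≤ 3 := by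
  obtain ⟨hcard, hinf⟩ := h
  have hsize : ℓ * 10 ≤ N'.card * 4 := by
    rw [div_le_iff₀ (by norm_num)] at hcard
    exact_mod_cast hcard
  have hfirst : ∃ i ∈ N', (i : ℕ) < 8 := by
    by_contra! hge
    have hsub : N' ⊆ {8, 9} := by
      intro i hi
      have hi8 := hge i hi
      revert hi8
      clear hi
      revert i
      decide
    have hle : N'.card ≤ 2 := card_le_card hsub
    omega
  refine ⟨hfirst, ?_⟩
  obtain ⟨i, hi, hi8⟩ := hfirst
  have hsub : N' ⊆ univ.filter fun j : Fin 10 => (j : ℕ) < 8 := by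
    intro j hj
    by_contra hj8
    have hdisj : A₁₉ i ∩ A₁₉ j = ∅ := by
      have hj8 : ¬ (j : ℕ) < 8 := by simpa using hj8
      simp only [A₁₉, hi8, hj8, if_true, if_false]
      decide
    have hle : N'.inf A₁₉ ≤ A₁₉ i ∩ A₁₉ j := le_inf (inf_le hi) (inf_le hj)
    have hcard_le := card_le_card hle
    rw [hdisj, card_empty] at hcard_le
    omega
  have hle : N'.card ≤ 8 := card_le_card hsub
  omega

/-- A committee containing three candidates approved by every voter of the first block
satisfies EJR. -/
lemma EJR_of_three_le_card_inter {W : Finset (Fin 5)}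
    (hW : ∀ i : Fin 10, (i : ℕ) < 8 → 3 ≤ (A₁₉ i ∩ W).card) : EJR 4 A₁₉ W := by
  intro ℓ hℓ N' hN'
  obtain ⟨⟨i, hi, hi8⟩, hle⟩ := hN'.exists_lt_eight_and_le_three hℓ
  exact ⟨i, hi, hle.trans (hW i hi8)⟩

theorem EJR_committee_may_fail_positive_share :
    EJR 4 A₁₉ W₁₉ ∧ (∃ i : Fin 10, A₁₉ i ∩ W₁₉ = ∅) ∧
    EJR 4 A₁₉ W₁₉' ∧ IFS 4 A₁₉ (fun c => if c ∈ W₁₉' then (1 : ℝ) else 0) := by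
  refine ⟨EJR_of_three_le_card_inter (by decide), ⟨9, by decide⟩,
    EJR_of_three_le_card_inter (by decide), fun i => ?_⟩
  have hmin : min 4 (A₁₉ i).card ≤ 10 * (A₁₉ i ∩ W₁₉').card := by
    revert i
    decide
  have hutility : utility A₁₉ (fun c => if c ∈ W₁₉' then (1 : ℝ) else 0) i =
      ((A₁₉ i ∩ W₁₉').card : ℝ) := by
    simp [utility, sum_ite_mem]
  have hcast : ((min 4 (A₁₉ i).card : ℕ) : ℝ) ≤ 10 * ((A₁₉ i ∩ W₁₉').card : ℝ) := by
    exact_mod_cast hmin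
  rw [hutility]
  norm_num only [Nat.cast_ofNat]
  linarith

end BWCV
end
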